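/- Let C be a nonempty proper prefix of the pattern S. Then the first-occurrence time of S decomposes as the independent sum of the first-occurrence time of C and a head-start residual: for every real z with 0 ≤ z < 1, F_S(z) = F_C(z) · F_{S|C}(z), where F_{S|C} is the generating function of the head-start first-occurrence time of S given C. -/

import Mathlib

open MeasureTheory ENNReal

def occursAt (S : List Bool) (ω : ℕ → Bool) (n : ℕ) : Prop :=
  S.length ≤ n ∧ ∀ j < S.length, ω (n - S.length + j) = S.getD j false

noncomputable def firstOcc (S : List Bool) (ω : ℕ → Bool) : ℕ∞ :=
  ⨅ (n : ℕ) (_ : occursAt S ω n), (n : ℕ∞)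

noncomputable def f (μ : Measure (ℕ → Bool)) (S : List Bool) (n : ℕ) : ℝ≥0∞ :=
  μ {ω | firstOcc S ω = (n : ℕ∞)}

/-- The probability generating function `F_S(z) = ∑ f_n zⁿ`. -/
noncomputable def F (μ : Measure (ℕ → Bool)) (S : List Bool) (z : ℝ) : ℝ :=
  ∑' n : ℕ, (f μ S n).toReal * z ^ n

/-- The concatenated sequence `C ⌢ ω`. -/
def catSeq (C : List Bool) (ω : ℕ → Bool) : ℕ → Bool :=
  fun i => if i < C.length then C.getD i false else ω (i - C.length)

/-- The head-start first-occurrence time `T_{S|C}`: the least `n ≥ 1` such that `S`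
occurs ending at position `|C| + n` of `C ⌢ ω`. -/
noncomputable def headOcc (S C : List Bool) (ω : ℕ → Bool) : ℕ∞ :=
  ⨅ (n : ℕ) (_ : 1 ≤ n ∧ occursAt S (catSeq C ω) (C.length + n)), (n : ℕ∞)

noncomputable def fCond (μ : Measure (ℕ → Bool)) (S C : List Bool) (n : ℕ) : ℝ≥0∞ :=
  μ {ω | headOcc S C ω = (n : ℕ∞)}

/-- The head-start generating function `F_{S|C}(z)`. -/
noncomputable def Fcond (μ : Measure (ℕ → Bool)) (S C : List Bool) (z : ℝ) : ℝ :=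
  ∑' n : ℕ, (fCond μ S C n).toReal * z ^ n

/-- The `n`-cylinder at `b`. -/
def cylinderAt (n : ℕ) (b : ℕ → Bool) : Set (ℕ → Bool) := {ω | ∀ i < n, ω i = b i}

/-- The sequence `ω` with its first `i` symbols removed. -/
def shiftSeq (i : ℕ) (ω : ℕ → Bool) : ℕ → Bool := fun t => ω (i + t)

theorem measurable_shiftSeq (i : ℕ) : Measurable (shiftSeq i) := by
  unfold shiftSeq
  fun_prop

theorem iInf_natCast_eq_iff (P : ℕ → Prop) (m : ℕ) :
    (⨅ (n : ℕ) (_ : P n), (n : ℕ∞)) = m ↔ P m ∧ ∀ k < m, ¬ P k := by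
  constructor
  · intro h
    have hmin : ∀ k < m, ¬ P k := fun k hk hP => by
      have : (m : ℕ∞) ≤ k := h ▸ iInf₂_le k hP
      exact absurd (Nat.cast_le.1 this) (not_le.2 hk)
    refine ⟨?_, hmin⟩
    by_contra hm
    have : ((m + 1 : ℕ) : ℕ∞) ≤ m := by
      rw [← h]
      refine le_iInf₂ fun k hk => Nat.cast_le.2 ?_
      by_contra hlt
      rcases Nat.lt_or_eq_of_le (Nat.le_of_lt_succ (not_le.1 hlt)) with h' | h'
      · exact hmin k h' hk
      · exact hm (h' ▸ hk)
    exact absurd (Nat.cast_le.1 this) (by omega)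
  · rintro ⟨hm, hmin⟩
    refine le_antisymm (iInf₂_le m hm) (le_iInf₂ fun k hk => Nat.cast_le.2 ?_)
    exact not_lt.1 fun hlt => hmin k hlt hk

theorem firstOcc_eq_iff (S : List Bool) (ω : ℕ → Bool) (n : ℕ) :
    firstOcc S ω = n ↔ occursAt S ω n ∧ ∀ m < n, ¬ occursAt S ω m :=
  iInf_natCast_eq_iff _ _

theorem headOcc_eq_iff (S C : List Bool) (ω : ℕ → Bool) (n : ℕ) :
    headOcc S C ω = n ↔ (1 ≤ n ∧ occursAt S (catSeq C ω) (C.length + n)) ∧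
      ∀ m < n, ¬ (1 ≤ m ∧ occursAt S (catSeq C ω) (C.length + m)) :=
  iInf_natCast_eq_iff _ _

theorem occursAt_congr (S : List Bool) {ω ω' : ℕ → Bool} {n : ℕ}
    (h : ∀ i < n, ω i = ω' i) : occursAt S ω n ↔ occursAt S ω' n := by
  unfold occursAt
  refine and_congr_right fun hn => forall₂_congr fun j hj => ?_
  rw [h _ (by omega)]

theorem dependsOn_firstOcc (S : List Bool) (n : ℕ) :
    DependsOn (fun ω => firstOcc S ω = n) (Set.Iio n) := by
  intro ω ω' h
  simp only [Set.mem_Iio] at h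
  simp only [firstOcc_eq_iff, eq_iff_iff]
  exact and_congr (occursAt_congr S h) <| forall₂_congr fun m hm =>
    not_congr <| occursAt_congr S fun i hi => h i (hi.trans hm)

theorem catSeq_congr (C : List Bool) {ω ω' : ℕ → Bool} {n : ℕ}
    (h : ∀ i < n, ω i = ω' i) : ∀ i < C.length + n, catSeq C ω i = catSeq C ω' i := by
  intro i hi
  unfold catSeq
  split_ifs
  · rfl
  · exact h _ (by omega)

theorem dependsOn_headOcc (S C : List Bool) (n : ℕ) :
    DependsOn (fun ω => headOcc S C ω = n) (Set.Iio n) := by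
  intro ω ω' h
  simp only [Set.mem_Iio] at h
  simp only [headOcc_eq_iff, eq_iff_iff]
  exact and_congr (and_congr_right fun _ => occursAt_congr S (catSeq_congr C h)) <|
    forall₂_congr fun m hm => not_congr <| and_congr_right fun _ =>
      occursAt_congr S (catSeq_congr C fun i hi => h i (hi.trans hm))

/-- A set determined by the first `n` coordinates is a preimage under the restriction map. -/
theorem exists_eq_preimage_of_dependsOn {A : Set (ℕ → Bool)} {n : ℕ}
    (hA : DependsOn (· ∈ A) (Set.Iio n)) :
    ∃ s : Set (Fin n → Bool), A = (fun ω (i : Fin n) => ω i) ⁻¹' s := by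
  refine ⟨{x | (fun i => if h : i < n then x ⟨i, h⟩ else false) ∈ A}, ?_⟩
  ext ω
  simp only [Set.mem_preimage, Set.mem_ofPred_eq]
  refine Iff.of_eq (hA fun i hi => ?_)
  simp only [Set.mem_Iio] at hi
  simp [hi]

theorem measurableSet_of_dependsOn {A : Set (ℕ → Bool)} {n : ℕ}
    (hA : DependsOn (· ∈ A) (Set.Iio n)) : MeasurableSet A := by
  obtain ⟨s, rfl⟩ := exists_eq_preimage_of_dependsOn hA
  exact (by fun_prop : Measurable fun (ω : ℕ → Bool) (i : Fin n) => ω i) s.toFinite.measurableSet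

theorem measurableSet_cylinderAt (n : ℕ) (b : ℕ → Bool) : MeasurableSet (cylinderAt n b) := by
  refine measurableSet_of_dependsOn (n := n) fun ω ω' h => ?_
  simp only [Set.mem_Iio] at h
  simp only [cylinderAt, Set.mem_ofPred_eq, eq_iff_iff]
  exact forall₂_congr fun i hi => by rw [h i hi]

/-- Measures agreeing on `n`-cylinders agree on sets determined by the first `n` coordinates. -/
theorem measure_eq_of_cylinderAt {ν₁ ν₂ : Measure (ℕ → Bool)} {n : ℕ}
    (h : ∀ b, ν₁ (cylinderAt n b) = ν₂ (cylinderAt n b)) {A : Set (ℕ → Bool)}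
    (hA : DependsOn (· ∈ A) (Set.Iio n)) : ν₁ A = ν₂ A := by
  obtain ⟨s, rfl⟩ := exists_eq_preimage_of_dependsOn hA
  have hr : Measurable fun (ω : ℕ → Bool) (i : Fin n) => ω i := by fun_prop
  have hmap : ν₁.map (fun ω (i : Fin n) => ω i) = ν₂.map (fun ω (i : Fin n) => ω i) := by
    refine Measure.ext_of_singleton fun x => ?_
    rw [Measure.map_apply hr (measurableSet_singleton x),
      Measure.map_apply hr (measurableSet_singleton x)]
    convert h (fun i => if h : i < n then x ⟨i, h⟩ else false) using 2 <;>
    · ext ω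
      simp only [Set.mem_preimage, Set.mem_singleton_iff, funext_iff, cylinderAt,
        Set.mem_ofPred_eq, Fin.forall_iff]
      exact forall₂_congr fun i hi => by simp [hi]
  rw [← Measure.map_apply hr s.toFinite.measurableSet, hmap,
    Measure.map_apply hr s.toFinite.measurableSet]

/-- Under a product measure, events determined by the first `i` trials are independent of
events determined by the next `j` trials. -/
theorem measure_inter_shiftSeq_preimage {μ : Measure (ℕ → Bool)} {w : Bool → ℝ≥0∞}
    (hμ : ∀ n b, μ (cylinderAt n b) = ∏ i ∈ Finset.range n, w (b i)) {A B : Set (ℕ → Bool)}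
    {i j : ℕ} (hA : DependsOn (· ∈ A) (Set.Iio i)) (hB : DependsOn (· ∈ B) (Set.Iio j)) :
    μ (A ∩ shiftSeq i ⁻¹' B) = μ A * μ B := by
  have hBm := measurableSet_of_dependsOn hB
  have hcyl (b b' : ℕ → Bool) : μ (shiftSeq i ⁻¹' cylinderAt j b' ∩ cylinderAt i b) =
      μ (cylinderAt i b) * μ (cylinderAt j b') := by
    have hset : shiftSeq i ⁻¹' cylinderAt j b' ∩ cylinderAt i b =
        cylinderAt (i + j) (fun t => if t < i then b t else b' (t - i)) := by
      ext ω
      simp only [cylinderAt, shiftSeq, Set.mem_inter_iff, Set.mem_preimage, Set.mem_ofPred_eq]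
      constructor
      · rintro ⟨h1, h2⟩ t ht
        split_ifs with hti
        · exact h2 t hti
        · rw [← h1 (t - i) (by omega)]
          congr 1
          omega
      · intro h
        refine ⟨fun t ht => ?_, fun t ht => ?_⟩
        · simpa using h (i + t) (by omega)
        · simpa [ht] using h t (by omega)
    rw [hset, hμ, hμ, hμ, Finset.prod_range_add]
    congr 1
    · exact Finset.prod_congr rfl fun t ht => by simp [Finset.mem_range.1 ht]
    · exact Finset.prod_congr rfl fun t _ => by simp
  have hB' (b : ℕ → Bool) :
      μ (shiftSeq i ⁻¹' B ∩ cylinderAt i b) = μ (cylinderAt i b) * μ B := by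
    have := measure_eq_of_cylinderAt (n := j)
      (ν₁ := (μ.restrict (cylinderAt i b)).map (shiftSeq i)) (ν₂ := μ (cylinderAt i b) • μ)
      (fun b' => by
        rw [Measure.map_apply (measurable_shiftSeq i) (measurableSet_cylinderAt j b'),
          Measure.restrict_apply (measurable_shiftSeq i (measurableSet_cylinderAt j b')), hcyl]
        rfl) hB
    rwa [Measure.map_apply (measurable_shiftSeq i) hBm,
      Measure.restrict_apply (measurable_shiftSeq i hBm)] at this
  have := measure_eq_of_cylinderAt (n := i)
    (ν₁ := μ.restrict (shiftSeq i ⁻¹' B)) (ν₂ := μ B • μ)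
    (fun b => by
      rw [Measure.restrict_apply (measurableSet_cylinderAt i b), Set.inter_comm, hB', mul_comm]
      rfl) hA
  rw [Measure.restrict_apply (measurableSet_of_dependsOn hA)] at this
  rw [this, mul_comm]
  rfl

theorem occursAt_of_prefix {S C : List Bool} (hpre : C <+: S) {ω : ℕ → Bool} {n : ℕ}
    (h : occursAt S ω n) : occursAt C ω (n - S.length + C.length) := by
  have hle := hpre.length_le
  refine ⟨by omega, fun j hj => ?_⟩
  obtain ⟨t, rfl⟩ := hpre
  rw [Nat.add_sub_cancel, h.2 j (by omega), List.getD_append _ _ _ _ hj]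

theorem catSeq_shiftSeq {C : List Bool} {ω : ℕ → Bool} {i : ℕ} (h : occursAt C ω i) (t : ℕ) :
    catSeq C (shiftSeq i ω) t = ω (i - C.length + t) := by
  have := h.1
  unfold catSeq shiftSeq
  split_ifs with ht
  · exact (h.2 t ht).symm
  · congr 1
    omega

/-- After the first occurrence of the prefix `C`, occurrences of `S` are those in the sequence
restarted with head start `C`. -/
theorem occursAt_catSeq_shiftSeq_iff {S C : List Bool} (hpre : C <+: S) {ω : ℕ → Bool} {i : ℕ}
    (hi : firstOcc C ω = i) (j : ℕ) :
    occursAt S (catSeq C (shiftSeq i ω)) (C.length + j) ↔ occursAt S ω (i + j) := by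
  obtain ⟨hocc, hmin⟩ := (firstOcc_eq_iff _ _ _).1 hi
  have hle := hocc.1
  have hlen (h : S.length ≤ C.length + j) (k : ℕ) :
      i - C.length + (C.length + j - S.length + k) = i + j - S.length + k := by omega
  constructor
  · rintro ⟨h1, h2⟩
    refine ⟨by omega, fun k hk => ?_⟩
    rw [← h2 k hk, catSeq_shiftSeq hocc, hlen h1]
  · intro h
    have h1 : S.length ≤ C.length + j := by
      by_contra hlt
      have := h.1
      exact hmin _ (by omega) (occursAt_of_prefix hpre h)
    refine ⟨h1, fun k hk => ?_⟩
    rw [← h.2 k hk, catSeq_shiftSeq hocc, hlen h1]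

theorem firstOcc_eq_iff_exists {S C : List Bool} (hpre : C <+: S) (hne : C ≠ S)
    (ω : ℕ → Bool) (n : ℕ) :
    firstOcc S ω = n ↔ ∃ x ∈ Finset.HasAntidiagonal.antidiagonal n,
      firstOcc C ω = (x.1 : ℕ) ∧ headOcc S C (shiftSeq x.1 ω) = (x.2 : ℕ) := by
  have hlt : C.length < S.length :=
    lt_of_le_of_ne hpre.length_le fun h => hne (hpre.eq_of_length h)
  have hbefore {m : ℕ} (h : occursAt S ω m) : ∃ i < m, occursAt C ω i :=
    ⟨_, by have := h.1; omega, occursAt_of_prefix hpre h⟩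
  rw [firstOcc_eq_iff]
  constructor
  · rintro ⟨hS, hmin⟩
    classical
    have hex : ∃ i, occursAt C ω i := (hbefore hS).imp fun _ h => h.2
    obtain ⟨i, hi⟩ : ∃ i : ℕ, firstOcc C ω = i :=
      ⟨Nat.find hex, (firstOcc_eq_iff _ _ _).2 ⟨Nat.find_spec hex, fun _ => Nat.find_min hex⟩⟩
    have hin : i < n := by
      obtain ⟨k, hk, hCk⟩ := hbefore hS
      by_contra h
      exact ((firstOcc_eq_iff _ _ _).1 hi).2 k (by omega) hCk
    refine ⟨(i, n - i), by simp; omega, hi, (headOcc_eq_iff _ _ _ _).2 ?_⟩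
    simp only [occursAt_catSeq_shiftSeq_iff hpre hi]
    refine ⟨⟨by omega, by rwa [Nat.add_sub_cancel' hin.le]⟩, fun m hm h => ?_⟩
    exact hmin _ (by omega) h.2
  · rintro ⟨⟨i, j⟩, hij, hi, hj⟩
    simp only [Finset.HasAntidiagonal.mem_antidiagonal] at hij hi hj
    subst hij
    rw [headOcc_eq_iff] at hj
    simp only [occursAt_catSeq_shiftSeq_iff hpre hi] at hj
    refine ⟨hj.1.2, fun m hm hS => ?_⟩
    obtain ⟨k, hk, hCk⟩ := hbefore hS
    have hik : i ≤ k := not_lt.1 fun h => ((firstOcc_eq_iff _ _ _).1 hi).2 k h hCk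
    exact hj.2 (m - i) (by omega) ⟨by omega, by rwa [Nat.add_sub_cancel' (by omega)]⟩

theorem f_eq_sum_antidiagonal {μ : Measure (ℕ → Bool)} {w : Bool → ℝ≥0∞}
    (hμ : ∀ n b, μ (cylinderAt n b) = ∏ i ∈ Finset.range n, w (b i))
    {S C : List Bool} (hpre : C <+: S) (hne : C ≠ S) (n : ℕ) :
    f μ S n = ∑ x ∈ Finset.HasAntidiagonal.antidiagonal n, f μ C x.1 * fCond μ S C x.2 := by
  have hset : {ω | firstOcc S ω = n} = ⋃ x ∈ Finset.HasAntidiagonal.antidiagonal n,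
      ({ω | firstOcc C ω = (x.1 : ℕ)} ∩ shiftSeq x.1 ⁻¹' {ω | headOcc S C ω = (x.2 : ℕ)}) := by
    ext ω
    simp only [Set.mem_iUnion, exists_prop]
    exact firstOcc_eq_iff_exists hpre hne ω n
  rw [f, hset, measure_biUnion_finset]
  · exact Finset.sum_congr rfl fun x _ =>
      measure_inter_shiftSeq_preimage hμ (dependsOn_firstOcc C x.1) (dependsOn_headOcc S C x.2)
  · intro x hx y hy hxy
    refine Set.disjoint_left.2 fun ω h1 h2 => hxy ?_
    have h : x.1 = y.1 := Nat.cast_injective (R := ℕ∞) (h1.1.symm.trans h2.1)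
    have hx' := Finset.HasAntidiagonal.mem_antidiagonal.1 hx
    have hy' := Finset.HasAntidiagonal.mem_antidiagonal.1 hy
    exact Prod.ext h (by omega)
  · exact fun x _ => (measurableSet_of_dependsOn (dependsOn_firstOcc C x.1)).inter
      (measurable_shiftSeq _ (measurableSet_of_dependsOn (dependsOn_headOcc S C x.2)))

theorem summable_norm_toReal_mul_pow {μ : Measure (ℕ → Bool)} [IsProbabilityMeasure μ]
    (E : ℕ → Set (ℕ → Bool)) {z : ℝ} (hz0 : 0 ≤ z) (hz1 : z < 1) :
    Summable fun n => ‖(μ (E n)).toReal * z ^ n‖ := by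
  refine Summable.of_nonneg_of_le (fun _ => norm_nonneg _) (fun n => ?_)
    (summable_geometric_of_lt_one hz0 hz1)
  rw [Real.norm_of_nonneg (by positivity)]
  exact mul_le_of_le_one_left (by positivity) measureReal_le_one

theorem stmt7 (p : ℝ) (hp0 : 0 < p) (hp1 : p < 1)
    (μ : Measure (ℕ → Bool)) [IsProbabilityMeasure μ]
    (hμ : ∀ (n : ℕ) (b : ℕ → Bool),
      μ {ω | ∀ i < n, ω i = b i}
        = ∏ i ∈ Finset.range n, (if b i then ENNReal.ofReal p else ENNReal.ofReal (1 - p)))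
    (S C : List Bool) (hC : C ≠ []) (hpre : C <+: S) (hne : C ≠ S)
    (z : ℝ) (hz0 : 0 ≤ z) (hz1 : z < 1) :
    F μ S z = F μ C z * Fcond μ S C z := by
  unfold F Fcond
  refine Eq.trans (tsum_congr fun n => ?_) (tsum_mul_tsum_eq_tsum_sum_antidiagonal_of_summable_norm
    (summable_norm_toReal_mul_pow (fun n => {ω | firstOcc C ω = n}) hz0 hz1)
    (summable_norm_toReal_mul_pow (fun n => {ω | headOcc S C ω = n}) hz0 hz1)).symm
  rw [f_eq_sum_antidiagonal
    (w := fun c => if c then ENNReal.ofReal p else ENNReal.ofReal (1 - p)) hμ hpre hne]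
  simp only [f, fCond]
  rw [ENNReal.toReal_sum
    fun x _ => ENNReal.mul_ne_top (measure_ne_top μ _) (measure_ne_top μ _), Finset.sum_mul]
  refine Finset.sum_congr rfl fun x hx => ?_
  rw [ENNReal.toReal_mul, ← Finset.HasAntidiagonal.mem_antidiagonal.1 hx, pow_add]
  ring
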